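/- Let S be a strictly proper scoring rule and p* ∈ int(Δ) a fixed point of f such that G is three times differentiable at p* (so D²g(p*) exists). Assume β ⪰ Dg(p*)|_T ⪰ γ > 0, that f is differentiable at p*, and ‖Df(p*)‖_op < γ/β. Then for all sufficiently small α > 0, the repeated-gradient iteration p_{t+1} = Π_Δ(p_t + α · Dg(p_t)ᵀ(f(p_t) − p_t)) converges locally to p*: there exists an open neighborhood U of p* (relative to Δ) such that for every initial point p_0 ∈ U, all iterates remain in U and p_t → p* as t → ∞. -/

import Mathlib

open Set Filter
open scoped RealInnerProductSpace

noncomputable section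

/-- The probability simplex over `n` outcomes, inside Euclidean space. -/
def probSimplex (n : ℕ) : Set (EuclideanSpace ℝ (Fin n)) :=
  {p | (∀ i, 0 ≤ p i) ∧ ∑ i, p i = 1}

/-- The tangent space `T` of the probability simplex: vectors with coordinates summing to 0. -/
def tangentSp (n : ℕ) : Set (EuclideanSpace ℝ (Fin n)) :=
  {v | ∑ i, v i = 0}

/-- The tangent space of the simplex, as a submodule. -/
def tangentSubmodule (n : ℕ) : Submodule ℝ (EuclideanSpace ℝ (Fin n)) where
  carrier := tangentSp n
  add_mem' {v w} hv hw := by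
    simp only [tangentSp, mem_ofPred_eq, PiLp.add_apply, Finset.sum_add_distrib] at *
    rw [hv, hw, add_zero]
  zero_mem' := by simp [tangentSp]
  smul_mem' c v hv := by
    simp only [tangentSp, mem_ofPred_eq, PiLp.smul_apply, smul_eq_mul, ← Finset.mul_sum] at *
    rw [hv, mul_zero]

theorem sub_mem_tangentSp {n : ℕ} {p q : EuclideanSpace ℝ (Fin n)}
    (hp : p ∈ probSimplex n) (hq : q ∈ probSimplex n) : q - p ∈ tangentSp n := by
  simp only [tangentSp, mem_ofPred_eq, PiLp.sub_apply, Finset.sum_sub_distrib]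
  rw [hp.2, hq.2, sub_self]

theorem convex_probSimplex (n : ℕ) : Convex ℝ (probSimplex n) := by
  intro x hx y hy a b ha hb hab
  refine ⟨fun i => ?_, ?_⟩
  · have h₁ := mul_nonneg ha (hx.1 i)
    have h₂ := mul_nonneg hb (hy.1 i)
    simpa using add_nonneg h₁ h₂
  · simp only [PiLp.add_apply, PiLp.smul_apply, smul_eq_mul, Finset.sum_add_distrib,
      ← Finset.mul_sum]
    rw [hx.2, hy.2, mul_one, mul_one, hab]

theorem eventually_add_mem_probSimplex {n : ℕ} {p : EuclideanSpace ℝ (Fin n)}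
    (hp : p ∈ probSimplex n) (hpos : ∀ i, 0 < p i) :
    ∀ᶠ x : tangentSubmodule n in nhds 0, p + (x : EuclideanSpace ℝ (Fin n)) ∈ probSimplex n := by
  have hev : ∀ᶠ x : tangentSubmodule n in nhds 0,
      ∀ i, 0 < (p + (x : EuclideanSpace ℝ (Fin n))) i := by
    refine eventually_all.2 fun i => ?_
    have hc : Continuous fun x : tangentSubmodule n =>
        (p + (x : EuclideanSpace ℝ (Fin n))) i := by fun_prop
    exact hc.continuousAt.eventually (lt_mem_nhds (by simpa using hpos i))
  filter_upwards [hev] with x hx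
  refine ⟨fun i => (hx i).le, ?_⟩
  have hx0 : ∑ i, (x : EuclideanSpace ℝ (Fin n)) i = 0 := x.2
  simp only [PiLp.add_apply, Finset.sum_add_distrib]
  rw [hp.2, hx0, add_zero]

section InnerProduct

variable {E : Type*} [NormedAddCommGroup E] [InnerProductSpace ℝ E]

/-- A derivative within `s` restricts to a derivative along a subspace `T` through a point around
which `s` contains the translate of `T`. -/
theorem HasFDerivWithinAt.comp_add_subtype {F : Type*} [NormedAddCommGroup F] [NormedSpace ℝ F]
    {T : Submodule ℝ E} {s : Set E} {p : E} {h : E → F} {h' : E →L[ℝ] F} {x : T}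
    (hh : HasFDerivWithinAt h h' s (p + x)) (hs : ∀ᶠ y : T in nhds x, p + (y : E) ∈ s) :
    HasFDerivAt (fun y : T => h (p + y)) (h'.comp T.subtypeL) x := by
  have hsub : HasFDerivAt (fun y : T => p + (y : E)) T.subtypeL x :=
    T.subtypeL.hasFDerivAt.const_add p
  have hcomp := HasFDerivWithinAt.comp (t := s) x hh
    (hsub.hasFDerivWithinAt (s := {y : T | p + (y : E) ∈ s})) fun y hy => hy
  exact hcomp.hasFDerivAt hs

/-- A continuous selection of subgradients is the derivative. -/
theorem hasFDerivWithinAt_of_subgradient {s : Set E} {G : E → ℝ} {g : E → E} {q : E} (hq : q ∈ s)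
    (hsub : ∀ q ∈ s, ∀ r ∈ s, G q + ⟪g q, r - q⟫ ≤ G r) (hg : ContinuousWithinAt g s q) :
    HasFDerivWithinAt G (innerSL ℝ (g q)) s q := by
  rw [hasFDerivWithinAt_iff_isLittleO, Asymptotics.isLittleO_iff]
  intro c hc
  have hev : ∀ᶠ r in nhdsWithin q s, dist (g r) (g q) < c :=
    hg.eventually (Metric.ball_mem_nhds _ hc)
  filter_upwards [hev, self_mem_nhdsWithin] with r hr hrs
  have h₁ := hsub q hq r hrs
  have h₂ := hsub r hrs q hq
  have h₃ : ⟪g r, q - r⟫ = -⟪g r, r - q⟫ := by rw [← inner_neg_right, neg_sub]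
  have h₄ : ⟪g r - g q, r - q⟫ ≤ c * ‖r - q‖ := by
    refine (real_inner_le_norm _ _).trans ?_
    rw [dist_eq_norm] at hr
    gcongr
  rw [inner_sub_left] at h₄
  rw [innerSL_apply_apply, Real.norm_eq_abs, abs_le]
  constructor <;> linarith [mul_nonneg hc.le (norm_nonneg (r - q))]

/-- The derivative of a selection of subgradients is symmetric. -/
theorem inner_fderiv_subgradient_symm {T : Submodule ℝ E} {s : Set E} {p : E} {G : E → ℝ}
    {g : E → E} {Dg : E → E →L[ℝ] E}
    (hs : ∀ᶠ x : T in nhds 0, p + (x : E) ∈ s)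
    (hsub : ∀ q ∈ s, ∀ r ∈ s, G q + ⟪g q, r - q⟫ ≤ G r)
    (hDg : ∀ q ∈ s, HasFDerivWithinAt g (Dg q) s q) {v w : E} (hv : v ∈ T) (hw : w ∈ T) :
    ⟪Dg p v, w⟫ = ⟪Dg p w, v⟫ := by
  have hp : p ∈ s := by simpa using hs.self_of_nhds
  have hG : ∀ᶠ x : T in nhds 0, HasFDerivAt (fun y : T => G (p + y))
      ((innerSL ℝ (g (p + x))).comp T.subtypeL) x := by
    filter_upwards [eventually_eventually_nhds.2 hs] with x hx
    have hxs := hx.self_of_nhds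
    exact (hasFDerivWithinAt_of_subgradient hxs hsub
      (hDg _ hxs).continuousWithinAt).comp_add_subtype hx
  have hg : HasFDerivAt (fun y : T => g (p + y)) ((Dg p).comp T.subtypeL) 0 :=
    HasFDerivWithinAt.comp_add_subtype (by simpa using hDg p hp) hs
  let L : E →L[ℝ] T →L[ℝ] ℝ :=
    ((ContinuousLinearMap.compL ℝ T E ℝ).flip T.subtypeL).comp (innerSL ℝ)
  have hg' : HasFDerivAt (fun y : T => (innerSL ℝ (g (p + y))).comp T.subtypeL)
      (L.comp ((Dg p).comp T.subtypeL)) 0 := by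
    have hL : HasFDerivAt (fun x : E => L x) L (g (p + (0 : T))) := L.hasFDerivAt
    have hcomp := HasFDerivAt.comp (G := T →L[ℝ] ℝ) (0 : T) hL hg
    exact hcomp
  exact second_derivative_symmetric_of_eventually hG hg' ⟨v, hv⟩ ⟨w, hw⟩

/-- A symmetric positive quadratic form on `T` bounded by `β` has operator norm at most `β`. -/
theorem norm_apply_le_of_quadratic_bounds {T : Submodule ℝ E} {A : E →L[ℝ] E} {β : ℝ}
    (hβ : 0 < β) (hsymm : ∀ v ∈ T, ∀ w ∈ T, ⟪A v, w⟫ = ⟪A w, v⟫) (hmaps : ∀ v ∈ T, A v ∈ T)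
    (hnonneg : ∀ v ∈ T, 0 ≤ ⟪v, A v⟫) (hupp : ∀ v ∈ T, ⟪v, A v⟫ ≤ β * ‖v‖ ^ 2)
    {v : E} (hv : v ∈ T) : ‖A v‖ ≤ β * ‖v‖ := by
  have hAv := hmaps v hv
  have h₀ := hnonneg _ (T.sub_mem (T.smul_mem β hv) hAv)
  have h₁ := hupp v hv
  have h₂ := hupp _ hAv
  have h₃ : ⟪v, A (A v)⟫ = ‖A v‖ ^ 2 := by
    rw [real_inner_comm, hsymm _ hAv _ hv, real_inner_self_eq_norm_sq]
  have h₄ : ⟪β • v - A v, A (β • v - A v)⟫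
      = β ^ 2 * ⟪v, A v⟫ - 2 * β * ‖A v‖ ^ 2 + ⟪A v, A (A v)⟫ := by
    simp only [map_sub, map_smul, inner_sub_left, inner_sub_right, real_inner_smul_left,
      real_inner_smul_right, h₃, real_inner_self_eq_norm_sq]
    ring
  rw [h₄] at h₀
  have h₅ : β * ‖A v‖ ^ 2 ≤ β * (β * ‖v‖) ^ 2 := by
    nlinarith [mul_le_mul_of_nonneg_left h₁ (sq_nonneg β)]
  exact le_of_sq_le_sq (le_of_mul_le_mul_left h₅ hβ) (by positivity)

theorem norm_sub_le_of_closest {s : Set E} (hs : Convex ℝ s) {x y p : E} (hy : y ∈ s)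
    (hmin : ∀ q ∈ s, ‖x - y‖ ≤ ‖x - q‖) (hp : p ∈ s) : ‖y - p‖ ≤ ‖x - p‖ := by
  have : Nonempty s := ⟨⟨y, hy⟩⟩
  have hinf : ‖x - y‖ = ⨅ w : s, ‖x - w‖ := by
    refine le_antisymm (le_ciInf fun w => hmin w w.2) ?_
    exact ciInf_le (f := fun w : s => ‖x - w‖)
      ⟨0, forall_mem_range.2 fun w => norm_nonneg _⟩ ⟨y, hy⟩
  have hinner := (norm_eq_iInf_iff_real_inner_le_zero hs hy).1 hinf p hp
  have hexp : ‖x - p‖ ^ 2 = ‖x - y‖ ^ 2 - 2 * ⟪x - y, p - y⟫ + ‖y - p‖ ^ 2 := by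
    rw [← norm_sub_rev p y, ← norm_sub_sq_real]
    congr 2
    abel
  exact le_of_sq_le_sq (by nlinarith [sq_nonneg ‖x - y‖]) (norm_nonneg _)

/-- Near a fixed point of `f`, the field `(Dg q)ᵀ (f q - q)` points towards it. -/
theorem eventually_inner_le_neg {s : Set E} {p : E} {f : E → E} {Dg : E → E →L[ℝ] E}
    {Df : E →L[ℝ] E} {β γ M : ℝ} (hfix : f p = p) (hcont : ContinuousWithinAt Dg s p)
    (hDf : HasFDerivWithinAt f Df s p)
    (hlow : ∀ q ∈ s, γ * ‖q - p‖ ^ 2 ≤ ⟪q - p, Dg p (q - p)⟫)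
    (hnorm : ∀ q ∈ s, ‖Dg p (q - p)‖ ≤ β * ‖q - p‖)
    (hM : ∀ q ∈ s, ‖Df (q - p)‖ ≤ M * ‖q - p‖) {c : ℝ} (hc : c < γ - β * M) :
    ∀ᶠ q in nhdsWithin p s, ⟪Dg q (q - p), f q - q⟫ ≤ -c * ‖q - p‖ ^ 2 := by
  set K : ℝ := ‖Df‖ + 2 + ‖Dg p‖ with hK
  have hKpos : 0 < K := by positivity
  obtain ⟨ε, hε0, hε1, hεK⟩ : ∃ ε : ℝ, 0 < ε ∧ ε ≤ 1 ∧ ε * K ≤ γ - β * M - c := by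
    refine ⟨min 1 ((γ - β * M - c) / K), lt_min one_pos (div_pos (by linarith) hKpos),
      min_le_left _ _, ?_⟩
    rw [← le_div_iff₀ hKpos]
    exact min_le_right _ _
  have hev : ∀ᶠ q in nhdsWithin p s, dist (Dg q) (Dg p) < ε :=
    hcont.eventually (Metric.ball_mem_nhds _ hε0)
  have hrem := (Asymptotics.isLittleO_iff.1 (hasFDerivWithinAt_iff_isLittleO.1 hDf)) hε0
  filter_upwards [hev, hrem, self_mem_nhdsWithin] with q hq hr hqs
  have hlow := hlow q hqs
  have hnorm := hnorm q hqs
  have hM := hM q hqs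
  rw [dist_eq_norm] at hq
  rw [hfix] at hr
  set v := q - p
  set r := f q - p - Df v with hrdef
  have hfq : f q - q = Df v - v + r := by simp only [hrdef, v]; abel
  have hv0 := norm_nonneg v
  have hfqn : ‖f q - q‖ ≤ (‖Df‖ + 2) * ‖v‖ := by
    rw [hfq]
    have h₁ := norm_add_le (Df v - v) r
    have h₂ := norm_sub_le (Df v) v
    have h₃ := Df.le_opNorm v
    nlinarith
  have h₁ : ⟪(Dg q - Dg p) v, f q - q⟫ ≤ (ε * ‖v‖) * ((‖Df‖ + 2) * ‖v‖) := by
    refine (real_inner_le_norm _ _).trans ?_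
    have := ((Dg q - Dg p).le_opNorm v).trans (mul_le_mul_of_nonneg_right hq.le hv0)
    gcongr
  have h₂ : ⟪Dg p v, Df v⟫ ≤ (β * ‖v‖) * (M * ‖v‖) :=
    (real_inner_le_norm _ _).trans
      (mul_le_mul hnorm hM (norm_nonneg _) ((norm_nonneg _).trans hnorm))
  have h₃ : ⟪Dg p v, r⟫ ≤ (‖Dg p‖ * ‖v‖) * (ε * ‖v‖) :=
    (real_inner_le_norm _ _).trans
      (mul_le_mul ((Dg p).le_opNorm v) hr (norm_nonneg _) (by positivity))
  have hsplit : ⟪Dg q v, f q - q⟫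
      = ⟪(Dg q - Dg p) v, f q - q⟫ + ⟪Dg p v, Df v⟫ - ⟪v, Dg p v⟫ + ⟪Dg p v, r⟫ := by
    have hp : ⟪Dg p v, f q - q⟫ = ⟪Dg p v, Df v⟫ - ⟪v, Dg p v⟫ + ⟪Dg p v, r⟫ := by
      rw [hfq, inner_add_right, inner_sub_right, real_inner_comm (Dg p v) v]
    rw [sub_apply, inner_sub_left, hp]
    ring
  rw [hsplit]
  have h₄ := mul_le_mul_of_nonneg_right hεK (sq_nonneg ‖v‖)
  rw [hK] at h₄
  nlinarith

/-- Near a fixed point of `f`, the field `(Dg q)ᵀ (f q - q)` grows at most linearly. -/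
theorem eventually_norm_adjoint_le [CompleteSpace E] {s : Set E} {p : E} {f : E → E}
    {Dg : E → E →L[ℝ] E} {Df : E →L[ℝ] E} (hfix : f p = p) (hcont : ContinuousWithinAt Dg s p)
    (hDf : HasFDerivWithinAt f Df s p) :
    ∀ᶠ q in nhdsWithin p s, ‖ContinuousLinearMap.adjoint (Dg q) (f q - q)‖
      ≤ (‖Dg p‖ + 1) * (‖Df‖ + 2) * ‖q - p‖ := by
  have hev : ∀ᶠ q in nhdsWithin p s, ‖Dg q‖ < ‖Dg p‖ + 1 :=
    hcont.norm.eventually (gt_mem_nhds (lt_add_one _))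
  have hrem := (Asymptotics.isLittleO_iff.1 (hasFDerivWithinAt_iff_isLittleO.1 hDf)) one_pos
  filter_upwards [hev, hrem] with q hq hr
  rw [hfix] at hr
  have hfq : f q - q = (f q - p - Df (q - p)) + Df (q - p) - (q - p) := by abel
  have hfqn : ‖f q - q‖ ≤ (‖Df‖ + 2) * ‖q - p‖ := by
    rw [hfq]
    have h₁ := norm_sub_le ((f q - p - Df (q - p)) + Df (q - p)) (q - p)
    have h₂ := norm_add_le (f q - p - Df (q - p)) (Df (q - p))
    have h₃ := Df.le_opNorm (q - p)
    linarith
  calc _ ≤ ‖ContinuousLinearMap.adjoint (Dg q)‖ * ‖f q - q‖ := ContinuousLinearMap.le_opNorm _ _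
    _ ≤ (‖Dg p‖ + 1) * ((‖Df‖ + 2) * ‖q - p‖) := by
      rw [LinearIsometryEquiv.norm_map]
      gcongr
    _ = _ := by ring

end InnerProduct

/-- A map contracting a relative ball towards its centre converges to it from that ball. -/
theorem forall_mem_and_tendsto_of_contracting {E : Type*} [NormedAddCommGroup E]
    {s : Set E} {x₀ : E} {δ k : ℝ} (hk0 : 0 ≤ k) (hk1 : k < 1) {F : E → E} (hFs : ∀ q, F q ∈ s)
    (hF : ∀ q ∈ Metric.ball x₀ δ ∩ s, ‖F q - x₀‖ ^ 2 ≤ k * ‖q - x₀‖ ^ 2) {p : ℕ → E}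
    (hp0 : p 0 ∈ Metric.ball x₀ δ ∩ s) (hp : ∀ t, p (t + 1) = F (p t)) :
    (∀ t, p t ∈ Metric.ball x₀ δ ∩ s) ∧ Tendsto p atTop (nhds x₀) := by
  have hmem : ∀ t, p t ∈ Metric.ball x₀ δ ∩ s := by
    intro t
    induction t with
    | zero => exact hp0
    | succ t ih =>
      refine ⟨?_, hp t ▸ hFs _⟩
      have h := hF _ ih
      rw [← hp t] at h
      have hle : ‖p (t + 1) - x₀‖ ≤ ‖p t - x₀‖ :=
        le_of_sq_le_sq (by nlinarith [sq_nonneg ‖p t - x₀‖]) (norm_nonneg _)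
      exact mem_ball_iff_norm.2 (hle.trans_lt (mem_ball_iff_norm.1 ih.1))
  refine ⟨hmem, ?_⟩
  have hbound : ∀ t, ‖p t - x₀‖ ^ 2 ≤ k ^ t * ‖p 0 - x₀‖ ^ 2 := by
    intro t
    induction t with
    | zero => simp
    | succ t ih =>
      rw [hp t, pow_succ' k, mul_assoc]
      exact (hF _ (hmem t)).trans (mul_le_mul_of_nonneg_left ih hk0)
  have hlim : Tendsto (fun t => k ^ t * ‖p 0 - x₀‖ ^ 2) atTop (nhds 0) := by
    simpa using (tendsto_pow_atTop_nhds_zero_of_lt_one hk0 hk1).mul_const (‖p 0 - x₀‖ ^ 2)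
  have hsq := squeeze_zero (fun t => sq_nonneg ‖p t - x₀‖) hbound hlim
  rw [tendsto_iff_norm_sub_tendsto_zero]
  simpa using hsq.sqrt

theorem fderivWithin_mem_tangentSp {n : ℕ} {g : EuclideanSpace ℝ (Fin n) → EuclideanSpace ℝ (Fin n)}
    {p : EuclideanSpace ℝ (Fin n)} (hp : p ∈ probSimplex n) (hpos : ∀ i, 0 < p i)
    (hgT : ∀ q ∈ probSimplex n, g q ∈ tangentSp n)
    {A : EuclideanSpace ℝ (Fin n) →L[ℝ] EuclideanSpace ℝ (Fin n)}
    (hA : HasFDerivWithinAt g A (probSimplex n) p)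
    {v : EuclideanSpace ℝ (Fin n)} (hv : v ∈ tangentSp n) : A v ∈ tangentSp n := by
  have hs := eventually_add_mem_probSimplex hp hpos
  have hg : HasFDerivAt (fun y : tangentSubmodule n => g (p + y))
      (A.comp (tangentSubmodule n).subtypeL) 0 :=
    HasFDerivWithinAt.comp_add_subtype (by simpa using hA) hs
  let ℓ : EuclideanSpace ℝ (Fin n) →L[ℝ] ℝ := ∑ i, EuclideanSpace.proj i
  have hℓ : ∀ x, ℓ x = ∑ i, x i := fun x => by simp [ℓ]
  have hcomp := ℓ.hasFDerivAt.comp (0 : tangentSubmodule n) hg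
  have hzero : HasFDerivAt (fun _ : tangentSubmodule n => (0 : ℝ))
      (ℓ.comp (A.comp (tangentSubmodule n).subtypeL)) 0 := by
    refine hcomp.congr_of_eventuallyEq ?_
    filter_upwards [hs] with x hx
    exact ((hℓ _).trans (hgT _ hx)).symm
  have heq := hzero.unique (hasFDerivAt_const (0 : ℝ) (0 : tangentSubmodule n))
  have := DFunLike.congr_fun heq (⟨v, hv⟩ : tangentSubmodule n)
  exact (hℓ _).symm.trans this

/-- Let `S(x,q) = G x + ⟪g x, q - x⟫` be a strictly proper scoring rule
and `p* ∈ int Δ` a fixed point of `f`, with `G` three times differentiable at `p*`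
(i.e. `g` differentiable on `Δ` with Jacobian `Dg`, and `Dg` differentiable at `p*`).
Assume `β ⪰ Dg(p*)|_T ⪰ γ > 0`, `f` differentiable at `p*`, and `‖Df(p*)‖_op < γ/β`
(on `T`). Then for all sufficiently small `α > 0`, the repeated-gradient iteration
`p_{t+1} = Π_Δ(p_t + α · Dg(p_t)ᵀ (f(p_t) − p_t))` (with `Π_Δ` the Euclidean projection
onto the simplex) converges locally to `p*`: there is an open `V ∋ p*` such that every
iteration sequence started in `V ∩ Δ` stays in `V ∩ Δ` and tends to `p*`. -/
theorem stmt17 (n : ℕ)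
    (G : EuclideanSpace ℝ (Fin n) → ℝ)
    (g f : EuclideanSpace ℝ (Fin n) → EuclideanSpace ℝ (Fin n))
    (proj : EuclideanSpace ℝ (Fin n) → EuclideanSpace ℝ (Fin n))
    (hproj : ∀ x, proj x ∈ probSimplex n ∧ ∀ q ∈ probSimplex n, ‖x - proj x‖ ≤ ‖x - q‖)
    (hG : StrictConvexOn ℝ (probSimplex n) G)
    (hsub : ∀ q ∈ probSimplex n, ∀ r ∈ probSimplex n, G q + ⟪g q, r - q⟫ ≤ G r)
    (hgT : ∀ q ∈ probSimplex n, g q ∈ tangentSp n)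
    (hf : ∀ q ∈ probSimplex n, f q ∈ probSimplex n)
    (pstar : EuclideanSpace ℝ (Fin n))
    (hpΔ : pstar ∈ probSimplex n) (hpint : ∀ i, 0 < pstar i)
    (hfix : f pstar = pstar)
    (Dg : EuclideanSpace ℝ (Fin n) →
      EuclideanSpace ℝ (Fin n) →L[ℝ] EuclideanSpace ℝ (Fin n))
    (hDg : ∀ q ∈ probSimplex n, HasFDerivWithinAt g (Dg q) (probSimplex n) q)
    (hD2g : DifferentiableWithinAt ℝ Dg (probSimplex n) pstar)
    (β γ : ℝ) (hγ : 0 < γ)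
    (hlow : ∀ v ∈ tangentSp n, γ * ‖v‖ ^ 2 ≤ ⟪v, Dg pstar v⟫)
    (hupp : ∀ v ∈ tangentSp n, ⟪v, Dg pstar v⟫ ≤ β * ‖v‖ ^ 2)
    (Df : EuclideanSpace ℝ (Fin n) →L[ℝ] EuclideanSpace ℝ (Fin n))
    (hDf : HasFDerivWithinAt f Df (probSimplex n) pstar)
    (hDfsmall : ∃ M : ℝ, (∀ v ∈ tangentSp n, ‖Df v‖ ≤ M * ‖v‖) ∧ M < γ / β) :
    ∃ α₀ : ℝ, 0 < α₀ ∧ ∀ α : ℝ, 0 < α → α ≤ α₀ →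
      ∃ V : Set (EuclideanSpace ℝ (Fin n)), IsOpen V ∧ pstar ∈ V ∧
        ∀ p : ℕ → EuclideanSpace ℝ (Fin n),
          p 0 ∈ V ∩ probSimplex n →
          (∀ t : ℕ, p (t + 1) =
            proj (p t + α • (ContinuousLinearMap.adjoint (Dg (p t))) (f (p t) - p t))) →
          (∀ t : ℕ, p t ∈ V ∩ probSimplex n) ∧ Tendsto p atTop (nhds pstar) := by
  obtain ⟨M, hM, hMlt⟩ := hDfsmall
  by_cases htriv : ∀ v ∈ tangentSp n, v = 0
  · have huniq : ∀ q ∈ probSimplex n, q = pstar := fun q hq =>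
      sub_eq_zero.1 (htriv _ (sub_mem_tangentSp hpΔ hq))
    refine ⟨1, one_pos, fun α _ _ => ⟨univ, isOpen_univ, mem_univ _, fun p hp0 hp => ?_⟩⟩
    have hmem : ∀ t, p t ∈ probSimplex n := by
      intro t
      cases t with
      | zero => exact hp0.2
      | succ t => exact hp t ▸ (hproj _).1
    refine ⟨fun t => ⟨mem_univ _, hmem t⟩, ?_⟩
    rw [show p = fun _ => pstar from funext fun t => huniq _ (hmem t)]
    exact tendsto_const_nhds
  push Not at htriv
  obtain ⟨u, hu, hu0⟩ := htriv
  have hβ : 0 < β := by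
    have hupos : 0 < ‖u‖ ^ 2 := by positivity
    exact hγ.trans_le (le_of_mul_le_mul_right ((hlow u hu).trans (hupp u hu)) hupos)
  have hgap : 0 < γ - β * M := by
    rw [lt_div_iff₀ hβ] at hMlt
    linarith
  have hs := eventually_add_mem_probSimplex hpΔ hpint
  have hnorm : ∀ v ∈ tangentSp n, ‖Dg pstar v‖ ≤ β * ‖v‖ := fun v hv =>
    norm_apply_le_of_quadratic_bounds (T := tangentSubmodule n) hβ
      (fun v hv w hw => inner_fderiv_subgradient_symm hs hsub hDg hv hw)
      (fun v hv => fderivWithin_mem_tangentSp hpΔ hpint hgT (hDg _ hpΔ) hv)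
      (fun v hv => (by positivity : 0 ≤ γ * ‖v‖ ^ 2).trans (hlow v hv)) hupp hv
  obtain ⟨c, hc0, hc⟩ := exists_between hgap
  have hT : ∀ q ∈ probSimplex n, q - pstar ∈ tangentSp n := fun q hq => sub_mem_tangentSp hpΔ hq
  have hinner := eventually_inner_le_neg hfix hD2g.continuousWithinAt hDf
    (fun q hq => hlow _ (hT q hq)) (fun q hq => hnorm _ (hT q hq)) (fun q hq => hM _ (hT q hq)) hc
  have hgrow := eventually_norm_adjoint_le hfix hD2g.continuousWithinAt hDf
  set C : ℝ := (‖Dg pstar‖ + 1) * (‖Df‖ + 2)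
  have hC : 0 < C := by positivity
  obtain ⟨δ, hδ, hball⟩ := Metric.mem_nhdsWithin_iff.1 (hinner.and hgrow)
  refine ⟨min (c / C ^ 2) (1 / c), by positivity, fun α hα hαle =>
    ⟨Metric.ball pstar δ, Metric.isOpen_ball, Metric.mem_ball_self hδ, fun p hp0 hp => ?_⟩⟩
  have hα₁ : α * C ^ 2 ≤ c := (le_div_iff₀ (by positivity)).1 (hαle.trans (min_le_left _ _))
  have hα₂ : α * c ≤ 1 := (le_div_iff₀ hc0).1 (hαle.trans (min_le_right _ _))
  refine forall_mem_and_tendsto_of_contracting (k := 1 - α * c)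
    (F := fun q => proj (q + α • (ContinuousLinearMap.adjoint (Dg q)) (f q - q)))
    (by linarith) (by nlinarith) (fun q => (hproj _).1) (fun q hq => ?_) hp0 hp
  obtain ⟨h₁, h₂⟩ := hball hq
  set d := (ContinuousLinearMap.adjoint (Dg q)) (f q - q) with hd
  have h₃ : ⟪q - pstar, d⟫ ≤ -c * ‖q - pstar‖ ^ 2 := by
    rwa [hd, ContinuousLinearMap.adjoint_inner_right]
  have h₄ : ‖d‖ ^ 2 ≤ C ^ 2 * ‖q - pstar‖ ^ 2 := by
    rw [← mul_pow]
    exact pow_le_pow_left₀ (norm_nonneg _) h₂ 2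
  have h₅ := norm_sub_le_of_closest (convex_probSimplex n) (hproj (q + α • d)).1
    (hproj (q + α • d)).2 hpΔ
  have h₆ : ‖q + α • d - pstar‖ ^ 2
      = ‖q - pstar‖ ^ 2 + 2 * (α * ⟪q - pstar, d⟫) + α ^ 2 * ‖d‖ ^ 2 := by
    rw [show q + α • d - pstar = (q - pstar) + α • d by abel, norm_add_sq_real,
      real_inner_smul_right, norm_smul, mul_pow, Real.norm_eq_abs, sq_abs]
  have h₇ := mul_le_mul_of_nonneg_left h₃ hα.le
  have h₈ := mul_le_mul_of_nonneg_left h₄ (sq_nonneg α)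
  have h₉ := mul_le_mul_of_nonneg_right (mul_le_mul_of_nonneg_left hα₁ hα.le)
    (sq_nonneg ‖q - pstar‖)
  calc _ ≤ ‖q + α • d - pstar‖ ^ 2 := pow_le_pow_left₀ (norm_nonneg _) h₅ 2
    _ ≤ _ := by
      rw [h₆]
      nlinarith
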